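/- Let D be the discrete polymatroid on the ground set {1,2,3} with rank function ρ given by ρ(∅) = 0, ρ({1}) = ρ({2}) = ρ({2,3}) = 2, ρ({3}) = 1, and ρ({1,2}) = ρ({1,3}) = ρ({1,2,3}) = 3. Then the index coding problem I^D(Z,R) constructed from D admits no scalar (dimension 1) perfect linear index coding solution over the field F_2 with two elements, even though D is representable over F_2. -/

import Mathlib

open scoped Classical

/-- Sum of the components of `u` indexed by the elements of `A`. -/
noncomputable def setSum {r : ℕ} (u : Fin r → ℕ) (A : Set (Fin r)) : ℕ :=
  ∑ i ∈ Finset.univ.filter (· ∈ A), u i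

/-- A discrete polymatroid on the ground set `{1,…,r}` (modelled as `Fin r`). -/
structure DiscretePolymatroid (r : ℕ) where
  carrier : Set (Fin r → ℕ)
  nonempty : carrier.Nonempty
  finite : carrier.Finite
  lower : ∀ u ∈ carrier, ∀ v : Fin r → ℕ, (∀ i, v i ≤ u i) → v ∈ carrier
  exchange : ∀ u ∈ carrier, ∀ v ∈ carrier, (∑ i, u i) < (∑ i, v i) →
    ∃ w ∈ carrier, (∀ i, u i ≤ w i) ∧ u ≠ w ∧ ∀ i, w i ≤ max (u i) (v i)

namespace DiscretePolymatroid

variable {r : ℕ} (D : DiscretePolymatroid r)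

/-- The rank function of a discrete polymatroid. -/
noncomputable def rho (A : Set (Fin r)) : ℕ :=
  D.finite.toFinset.sup fun u => setSum u A

/-- `ρ_max(D) = max_i ρ({i})`. -/
noncomputable def rhoMax : ℕ := Finset.univ.sup fun i : Fin r => D.rho {i}

/-- The rank of the discrete polymatroid (the common component sum of its basis vectors). -/
noncomputable def rank : ℕ := D.rho Set.univ

end DiscretePolymatroid

/-- The subspaces `V i` of `F^d` represent the rank function `ρ'` when
`dim (∑_{i ∈ X} V i) = ρ'(X)` for every `X`. -/
def RepFnOver (r : ℕ) (ρ' : Set (Fin r) → ℕ) (F : Type) [Field F] : Prop :=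
  ∃ (d : ℕ) (V : Fin r → Submodule F (Fin d → F)),
    ∀ X : Set (Fin r), Module.finrank F ↥(⨆ i ∈ X, V i) = ρ' X

/-- A discrete polymatroid is representable over `F` if its rank function is. -/
def DiscretePolymatroid.RepresentableOver {r : ℕ} (D : DiscretePolymatroid r)
    (F : Type) [Field F] : Prop :=
  RepFnOver r D.rho F


/-- An index coding problem with message index type `M`: a receiver `(x, H)` demands the
message `x` and has the set of messages `H` as side information. -/
structure IndexProblem (M : Type) where
  recv : Set (M × Set M)

/-- A linear index coding solution over `F` of length `c` and dimension `n`: each message is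
a row vector of length `n` over `F`, the encoding map `f` is linear, and every receiver can
recover its demanded message from its side information and `f(y)` by a linear decoding map. -/
def HasLinearIndexCode {M : Type} (P : IndexProblem M) (F : Type) [Field F]
    (n c : ℕ) : Prop :=
  ∃ f : ((M → Fin n → F) →ₗ[F] (Fin c → F)),
    ∀ p ∈ P.recv, ∃ ψ : ((↥p.2 → Fin n → F) × (Fin c → F)) →ₗ[F] (Fin n → F),
      ∀ y : M → Fin n → F, ψ (fun j => y j.1, f y) = y p.1

namespace DiscretePolymatroid

variable {r : ℕ} (D : DiscretePolymatroid r)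

/-- A basis vector of a discrete polymatroid: a maximal element of the carrier. -/
def IsBasisVec (b : Fin r → ℕ) : Prop :=
  b ∈ D.carrier ∧ ∀ u ∈ D.carrier, (∀ i, b i ≤ u i) → u = b

/-- An excluded vector of a discrete polymatroid. -/
def IsExcluded (u : Fin r → ℕ) : Prop :=
  (∀ i, u i ≤ D.rho {i}) ∧ u ∉ D.carrier

/-- A minimal excluded vector of a discrete polymatroid. -/
def IsMinExcluded (u : Fin r → ℕ) : Prop :=
  D.IsExcluded u ∧ ∀ v, D.IsExcluded v → (∀ i, v i ≤ u i) → v = u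

/-- The message index type of the index coding problem `I^D(Z,R)`:
`Sum.inl j` is the message `x_j` (`j ∈ {1,…,rank D}`), and `Sum.inr ⟨i,p⟩` is the message
`y_i^p` (`i ∈ {1,…,r}`, `p ∈ {1,…,ρ({i})}`). -/
@[reducible] noncomputable def Msg : Type :=
  Fin D.rank ⊕ (Σ i : Fin r, Fin (D.rho {i}))

/-- The number of elements of a subset `T` of `Y` lying in `ζ_l = {y_l^1,…,y_l^{ρ({l})}}`. -/
noncomputable def sliceCard (T : Set (Σ i : Fin r, Fin (D.rho {i}))) (l : Fin r) : ℕ :=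
  {p : Fin (D.rho {l}) | (⟨l, p⟩ : Σ i : Fin r, Fin (D.rho {i})) ∈ T}.ncard

/-- The index coding problem `I^D(Z,R)` constructed from the discrete polymatroid `D`,
with receiver set `R = R1 ∪ R2 ∪ R3`. -/
noncomputable def indexProblem : IndexProblem D.Msg where
  recv :=
    -- R1
    {pr | ∃ b : Fin r → ℕ, D.IsBasisVec b ∧ ∃ j : Fin D.rank,
        ∃ T : Set (Σ i : Fin r, Fin (D.rho {i})),
          (∀ l : Fin r, D.sliceCard T l = b l) ∧
          pr = (Sum.inl j, Sum.inr '' T)} ∪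
    -- R2
    {pr | ∃ c : Fin r → ℕ, D.IsMinExcluded c ∧ ∃ j : Fin r, c j ≠ 0 ∧
        ∃ p : Fin (D.rho {j}), ∃ T : Set (Σ i : Fin r, Fin (D.rho {i})),
          (∀ l : Fin r, l ≠ j → D.sliceCard T l = c l) ∧
          D.sliceCard T j = c j - 1 ∧
          (⟨j, p⟩ : Σ i : Fin r, Fin (D.rho {i})) ∉ T ∧
          pr = (Sum.inr ⟨j, p⟩, Sum.inr '' T)} ∪
    -- R3
    {pr | ∃ (i : Fin r) (p : Fin (D.rho {i})),
        pr = (Sum.inr ⟨i, p⟩, Set.range Sum.inl)}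

/-- `M(I^D(Z,R)) = ∑_{i=1}^r ρ({i})`: a perfect solution of dimension `n` has length
`n * indexCodeLen`. -/
noncomputable def indexCodeLen : ℕ := ∑ i : Fin r, D.rho {i}

/-- The bound `N(D)` on the field size. -/
noncomputable def Nbound : ℕ :=
  1 + Finset.univ.sup fun i : Fin r =>
    ∑ b ∈ D.finite.toFinset.filter (fun b => D.IsBasisVec b ∧ 0 < b i),
      Nat.choose (D.rho {i}) (b i - 1) *
        ∏ j ∈ (Finset.univ.filter fun j : Fin r => b j ≠ 0).erase i,
          Nat.choose (D.rho {j}) (b j)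

end DiscretePolymatroid

section LinearIndexCode

/-- A receiver of a linear index code decodes a message vanishing on its side information and
encoded to zero as zero. -/
theorem eq_zero_of_decodes {M F : Type} [Field F] {n c : ℕ} {H : Set M} {m : M}
    {f : (M → Fin n → F) →ₗ[F] (Fin c → F)}
    (h : ∃ ψ : ((↥H → Fin n → F) × (Fin c → F)) →ₗ[F] (Fin n → F),
      ∀ y : M → Fin n → F, ψ (fun j => y j.1, f y) = y m)
    {v : M → Fin n → F} (hv : f v = 0) (hH : ∀ j ∈ H, v j = 0) : v m = 0 := by
  obtain ⟨ψ, hψ⟩ := h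
  have h0 : (fun j : ↥H => v j.1) = 0 := funext fun j => hH j.1 j.2
  rw [← hψ v, hv, h0]
  exact map_zero ψ

/-- The kernel of a scalar code of length `c` on more than `c + 2` messages has a nonzero element
with two prescribed vanishing coordinates. -/
theorem exists_ne_zero_of_two_coords {M F : Type} [Fintype M] [Field F] {c : ℕ}
    (f : (M → Fin 1 → F) →ₗ[F] (Fin c → F)) (hc : c + 2 < Fintype.card M) (a b : M) :
    ∃ v, v ≠ 0 ∧ f v = 0 ∧ v a = 0 ∧ v b = 0 := by
  let g : (M → Fin 1 → F) →ₗ[F] (Fin c → F) × (Fin 1 → F) × (Fin 1 → F) :=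
    f.prod ((LinearMap.proj a).prod (LinearMap.proj b))
  have hg : LinearMap.ker g ≠ ⊥ := by
    apply LinearMap.ker_ne_bot_of_finrank_lt
    simp [Module.finrank_pi_fintype]
    omega
  obtain ⟨v, hv, hv0⟩ := (Submodule.ne_bot_iff _).1 hg
  refine ⟨v, hv0, ?_⟩
  simpa [g, LinearMap.mem_ker, Prod.ext_iff] using hv

theorem eq_one_of_ne_zero {x : Fin 1 → ZMod 2} (hx : x ≠ 0) : x = 1 := by
  revert x
  decide

end LinearIndexCode

namespace DiscretePolymatroid

variable {r : ℕ} (D : DiscretePolymatroid r)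

theorem setSum_le_rho {u : Fin r → ℕ} (hu : u ∈ D.carrier) (A : Set (Fin r)) :
    setSum u A ≤ D.rho A :=
  Finset.le_sup (f := fun u => setSum u A) (D.finite.mem_toFinset.2 hu)

theorem exists_setSum_eq_rho (A : Set (Fin r)) : ∃ u ∈ D.carrier, setSum u A = D.rho A := by
  obtain ⟨u, hu, h⟩ := Finset.exists_mem_eq_sup D.finite.toFinset
    (D.finite.toFinset_nonempty.2 D.nonempty) fun u => setSum u A
  exact ⟨u, D.finite.mem_toFinset.1 hu, h.symm⟩

/-- A member of `D` whose component sum is the rank is a basis vector. -/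
theorem isBasisVec_of_sum_eq_rank {b : Fin r → ℕ} (hb : b ∈ D.carrier)
    (hs : ∑ i, b i = D.rank) : D.IsBasisVec b := by
  refine ⟨hb, fun u hu hle => ?_⟩
  have h : ∑ i, u i ≤ ∑ i, b i := by
    rw [hs]
    simpa [setSum, rank] using D.setSum_le_rho hu Set.univ
  have h' := (Finset.sum_eq_sum_iff_of_le fun i _ => hle i).1
    (le_antisymm (Finset.sum_le_sum fun i _ => hle i) h)
  exact funext fun i => (h' i (Finset.mem_univ i)).symm

theorem sliceCard_setOf_mem {P : Fin r → Finset ℕ} {l : Fin r}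
    (hP : P l ⊆ Finset.range (D.rho {l})) :
    D.sliceCard {s | (s.2 : ℕ) ∈ P s.1} l = (P l).card := by
  unfold sliceCard
  rw [← Set.ncard_image_of_injective _ Fin.val_injective, ← Set.ncard_coe_finset]
  congr 1
  ext k
  constructor
  · rintro ⟨p, hp, rfl⟩
    exact hp
  · intro hk
    exact ⟨⟨k, Finset.mem_range.1 (hP hk)⟩, hk, rfl⟩

variable {F : Type} [Field F] {n c : ℕ} {f : (D.Msg → Fin n → F) →ₗ[F] (Fin c → F)}

/-- An element of the kernel of a code vanishing on the messages `y` selected by a basis vector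
is zero. -/
theorem eq_zero_of_isBasisVec
    (hf : ∀ p ∈ D.indexProblem.recv,
      ∃ ψ : ((↥p.2 → Fin n → F) × (Fin c → F)) →ₗ[F] (Fin n → F),
        ∀ y : D.Msg → Fin n → F, ψ (fun j => y j.1, f y) = y p.1)
    {b : Fin r → ℕ} (hb : D.IsBasisVec b) (P : Fin r → Finset ℕ)
    (hP : ∀ l, P l ⊆ Finset.range (D.rho {l})) (hPb : ∀ l, (P l).card = b l)
    {v : D.Msg → Fin n → F} (hv : f v = 0)
    (hvP : ∀ l, ∀ k ∈ P l, ∀ hk : k < D.rho {l}, v (Sum.inr ⟨l, ⟨k, hk⟩⟩) = 0) :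
    v = 0 := by
  have hx (j : Fin D.rank) : v (Sum.inl j) = 0 := by
    refine eq_zero_of_decodes (hf (Sum.inl j, Sum.inr '' {s | (s.2 : ℕ) ∈ P s.1})
      (Or.inl (Or.inl ⟨b, hb, j, _, fun l => ?_, rfl⟩))) hv ?_
    · rw [D.sliceCard_setOf_mem (hP l), hPb]
    · rintro _ ⟨⟨l, p⟩, hs, rfl⟩
      exact hvP l p hs p.2
  funext m
  rcases m with j | ⟨i, p⟩
  · exact hx j
  · refine eq_zero_of_decodes (hf (Sum.inr ⟨i, p⟩, Set.range Sum.inl)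
      (Or.inr ⟨i, p, rfl⟩)) hv ?_
    rintro _ ⟨j, rfl⟩
    exact hx j

/-- An element of the kernel of a code vanishing on all but one of the messages `y` selected by a
minimal excluded vector vanishes on the remaining one. -/
theorem eq_zero_of_isMinExcluded
    (hf : ∀ p ∈ D.indexProblem.recv,
      ∃ ψ : ((↥p.2 → Fin n → F) × (Fin c → F)) →ₗ[F] (Fin n → F),
        ∀ y : D.Msg → Fin n → F, ψ (fun j => y j.1, f y) = y p.1)
    {e : Fin r → ℕ} (he : D.IsMinExcluded e) {j : Fin r} (hj : e j ≠ 0)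
    (p : Fin (D.rho {j})) (P : Fin r → Finset ℕ)
    (hP : ∀ l, P l ⊆ Finset.range (D.rho {l})) (hPe : ∀ l, l ≠ j → (P l).card = e l)
    (hPj : (P j).card = e j - 1) (hp : (p : ℕ) ∉ P j)
    {v : D.Msg → Fin n → F} (hv : f v = 0)
    (hvP : ∀ l, ∀ k ∈ P l, ∀ hk : k < D.rho {l}, v (Sum.inr ⟨l, ⟨k, hk⟩⟩) = 0) :
    v (Sum.inr ⟨j, p⟩) = 0 := by
  refine eq_zero_of_decodes (hf (Sum.inr ⟨j, p⟩, Sum.inr '' {s | (s.2 : ℕ) ∈ P s.1})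
    (Or.inl (Or.inr ⟨e, he, j, hj, p, _, fun l hl => ?_, ?_, hp, rfl⟩))) hv ?_
  · rw [D.sliceCard_setOf_mem (hP l), hPe l hl]
  · rw [D.sliceCard_setOf_mem (hP j), hPj]
  · rintro _ ⟨⟨l, q⟩, hs, rfl⟩
    exact hvP l q hs q.2

end DiscretePolymatroid

/-- A function counting the elements of unions of subsets of a finite set is represented by
coordinate subspaces over every field. -/
theorem repFnOver_of_ncard_iUnion {r d : ℕ} {ρ' : Set (Fin r) → ℕ} (S : Fin r → Set (Fin d))
    (h : ∀ X : Set (Fin r), (⋃ i ∈ X, S i).ncard = ρ' X) (F : Type) [Field F] :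
    RepFnOver r ρ' F := by
  let e := Pi.basisFun F (Fin d)
  refine ⟨d, fun i => Submodule.span F (e '' S i), fun X => ?_⟩
  have hspan : (⨆ i ∈ X, Submodule.span F (e '' S i)) =
      Submodule.span F (e '' ⋃ i ∈ X, S i) := by
    simp only [Set.image_iUnion, Submodule.span_iUnion]
  have hli : LinearIndepOn F id (e '' ⋃ i ∈ X, S i) :=
    (e.linearIndependent.linearIndepOn (s := ⋃ i ∈ X, S i)).id_image
  rw [hspan, finrank_span_set_eq_card hli, ← Set.ncard_eq_toFinset_card',
    Set.ncard_image_of_injective _ e.injective, h]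

/-- **Lemma 9.** For the discrete polymatroid `D` on the ground set `{1,2,3}` (modelled
as `Fin 3` with `0,1,2`) with rank function `ρ(∅)=0`, `ρ({1})=ρ({2})=ρ({2,3})=2`,
`ρ({3})=1`, `ρ({1,2})=ρ({1,3})=ρ({1,2,3})=3`, the index coding problem `I^D(Z,R)` admits
no scalar (dimension `1`) perfect linear index coding solution over `F_2`, even though `D`
is representable over `F_2`. -/
theorem no_scalar_perfect_linear_index_code_over_F2
    (D : DiscretePolymatroid 3)
    (h1 : D.rho {0} = 2) (h2 : D.rho {1} = 2) (h3 : D.rho {2} = 1)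
    (h12 : D.rho {0, 1} = 3) (h13 : D.rho {0, 2} = 3) (h23 : D.rho {1, 2} = 2)
    (h123 : D.rho {0, 1, 2} = 3) :
    D.RepresentableOver (ZMod 2) ∧
    ¬ HasLinearIndexCode D.indexProblem (ZMod 2) 1 (1 * D.indexCodeLen) := by
  have hle := fun {u : Fin 3 → ℕ} (hu : u ∈ D.carrier) (A : Set (Fin 3)) => D.setSum_le_rho hu A
  have huniv : (Set.univ : Set (Fin 3)) = {0, 1, 2} := by
    ext i
    fin_cases i <;> simp
  have hrank : D.rank = 3 := by rw [DiscretePolymatroid.rank, huniv, h123]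
  have e0 (u : Fin 3 → ℕ) : setSum u {0} = u 0 := by
    simp [setSum, Finset.sum_filter]
  have e1 (u : Fin 3 → ℕ) : setSum u {1} = u 1 := by
    simp [setSum, Finset.sum_filter]
  have e2 (u : Fin 3 → ℕ) : setSum u {2} = u 2 := by
    simp [setSum, Finset.sum_filter]
  have e02 (u : Fin 3 → ℕ) : setSum u {0, 2} = u 0 + u 2 := by
    simp [setSum, Finset.sum_filter, Fin.sum_univ_three]
  have e12 (u : Fin 3 → ℕ) : setSum u {1, 2} = u 1 + u 2 := by
    simp [setSum, Finset.sum_filter, Fin.sum_univ_three]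
  have e012 (u : Fin 3 → ℕ) : setSum u {0, 1, 2} = u 0 + u 1 + u 2 := by
    simp [setSum, Finset.sum_filter, Fin.sum_univ_three]
  have bounds {u : Fin 3 → ℕ} (hu : u ∈ D.carrier) :
      u 0 ≤ 2 ∧ u 1 ≤ 2 ∧ u 2 ≤ 1 ∧ u 1 + u 2 ≤ 2 ∧ u 0 + u 1 + u 2 ≤ 3 := by
    have := hle hu {0}
    have := hle hu {1}
    have := hle hu {2}
    have := hle hu {1, 2}
    have := hle hu {0, 1, 2}
    simp only [*] at *
    omega
  have below {u v : Fin 3 → ℕ} (hu : u ∈ D.carrier) (a : v 0 ≤ u 0) (b : v 1 ≤ u 1)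
      (c : v 2 ≤ u 2) : v ∈ D.carrier :=
    D.lower u hu v (Fin.forall_fin_succ.2 ⟨a, Fin.forall_fin_two.2 ⟨b, c⟩⟩)
  have exch {u v : Fin 3 → ℕ} (hu : u ∈ D.carrier) (hv : v ∈ D.carrier)
      (h : u 0 + u 1 + u 2 < v 0 + v 1 + v 2) : ∃ w ∈ D.carrier,
      u 0 + u 1 + u 2 < w 0 + w 1 + w 2 ∧ (u 0 ≤ w 0 ∧ u 1 ≤ w 1 ∧ u 2 ≤ w 2) ∧
      w 0 ≤ max (u 0) (v 0) ∧ w 1 ≤ max (u 1) (v 1) ∧ w 2 ≤ max (u 2) (v 2) := by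
    obtain ⟨w, hw, hl, hne, hm⟩ := D.exchange u hu v hv (by simpa [Fin.sum_univ_three] using h)
    refine ⟨w, hw, ?_, ⟨hl 0, hl 1, hl 2⟩, hm 0, hm 1, hm 2⟩
    by_contra hlt
    have := hl 0
    have := hl 1
    have := hl 2
    refine hne (funext (Fin.forall_fin_succ.2 ⟨?_, Fin.forall_fin_two.2 ⟨?_, ?_⟩⟩))
    · omega
    · show u 1 = w 1
      omega
    · show u 2 = w 2
      omega
  have m020 : ![0, 2, 0] ∈ D.carrier := by
    obtain ⟨u, hu, h⟩ := D.exists_setSum_eq_rho {1}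
    rw [e1, h2] at h
    exact below hu (by simp) (by simp [h]) (by simp)
  have m201 : ![2, 0, 1] ∈ D.carrier := by
    obtain ⟨u, hu, h⟩ := D.exists_setSum_eq_rho {0, 2}
    rw [e02, h13] at h
    have := bounds hu
    exact below hu (by simp; omega) (by simp) (by simp; omega)
  have m120 : ![1, 2, 0] ∈ D.carrier := by
    obtain ⟨w, hw, h⟩ := exch m020 m201 (by simp)
    have := bounds hw
    simp at h
    exact below hw (by simp; omega) (by simp; omega) (by simp)
  have m210 : ![2, 1, 0] ∈ D.carrier := by
    obtain ⟨w, hw, h⟩ := exch (u := ![2, 0, 0]) (below m201 (by simp) (by simp) (by simp)) m120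
      (by simp)
    simp at h
    exact below hw (by simp; omega) (by simp; omega) (by simp)
  have m011 : ![0, 1, 1] ∈ D.carrier := by
    obtain ⟨w, hw, h⟩ := exch (u := ![0, 0, 1]) (below m201 (by simp) (by simp) (by simp)) m020
      (by simp)
    simp at h
    exact below hw (by simp) (by simp; omega) (by simp; omega)
  have m111 : ![1, 1, 1] ∈ D.carrier := by
    obtain ⟨w, hw, h⟩ := exch m011 m210 (by simp)
    simp at h
    exact below hw (by simp; omega) (by simp; omega) (by simp; omega)
  have b120 : D.IsBasisVec ![1, 2, 0] :=
    D.isBasisVec_of_sum_eq_rank m120 (by simp [Fin.sum_univ_three, hrank])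
  have b210 : D.IsBasisVec ![2, 1, 0] :=
    D.isBasisVec_of_sum_eq_rank m210 (by simp [Fin.sum_univ_three, hrank])
  have b201 : D.IsBasisVec ![2, 0, 1] :=
    D.isBasisVec_of_sum_eq_rank m201 (by simp [Fin.sum_univ_three, hrank])
  have b111 : D.IsBasisVec ![1, 1, 1] :=
    D.isBasisVec_of_sum_eq_rank m111 (by simp [Fin.sum_univ_three, hrank])
  have x021 : D.IsMinExcluded ![0, 2, 1] := by
    refine ⟨⟨?_, fun h => ?_⟩, fun v hv hvu => ?_⟩
    · simp [Fin.forall_fin_succ, h1, h2, h3]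
    · have := bounds h
      simp at this
    · have v0 : v 0 ≤ 0 := hvu 0
      have v1 : v 1 ≤ 2 := hvu 1
      have v2 : v 2 ≤ 1 := hvu 2
      by_cases c2 : v 2 = 0
      · exact absurd (below m020 v0 v1 c2.le) hv.2
      by_cases c1 : v 1 ≤ 1
      · exact absurd (below m011 v0 c1 v2) hv.2
      refine funext (Fin.forall_fin_succ.2 ⟨?_, Fin.forall_fin_two.2 ⟨?_, ?_⟩⟩)
      · exact Nat.le_zero.1 v0
      · show v 1 = 2
        omega
      · show v 2 = 1
        omega
  constructor
  · refine repFnOver_of_ncard_iUnion (d := 3) ![{0, 1}, {1, 2}, {2}] (fun X => ?_) (ZMod 2)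
    have h0 : D.rho ∅ = 0 := by simp [DiscretePolymatroid.rho, setSum]
    have count (A : Set (Fin 3)) (T : Finset (Fin 3)) (hA : X = A)
        (hT : (⋃ i ∈ A, (![{0, 1}, {1, 2}, {2}] : Fin 3 → Set (Fin 3)) i) = T)
        (hc : D.rho A = T.card) :
        (⋃ i ∈ X, (![{0, 1}, {1, 2}, {2}] : Fin 3 → Set (Fin 3)) i).ncard = D.rho X := by
      rw [hA, hT, Set.ncard_coe_finset, hc]
    by_cases x0 : (0 : Fin 3) ∈ X <;> by_cases x1 : (1 : Fin 3) ∈ X <;>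
      by_cases x2 : (2 : Fin 3) ∈ X
    · exact count {0, 1, 2} {0, 1, 2} (by ext i; fin_cases i <;> simp [x0, x1, x2])
        (by ext i; fin_cases i <;> simp) h123
    · exact count {0, 1} {0, 1, 2} (by ext i; fin_cases i <;> simp [x0, x1, x2])
        (by ext i; fin_cases i <;> simp) h12
    · exact count {0, 2} {0, 1, 2} (by ext i; fin_cases i <;> simp [x0, x1, x2])
        (by ext i; fin_cases i <;> simp) h13
    · exact count {0} {0, 1} (by ext i; fin_cases i <;> simp [x0, x1, x2])
        (by ext i; fin_cases i <;> simp) h1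
    · exact count {1, 2} {1, 2} (by ext i; fin_cases i <;> simp [x0, x1, x2])
        (by ext i; fin_cases i <;> simp) h23
    · exact count {1} {1, 2} (by ext i; fin_cases i <;> simp [x0, x1, x2])
        (by ext i; fin_cases i <;> simp) h2
    · exact count {2} {2} (by ext i; fin_cases i <;> simp [x0, x1, x2])
        (by ext i; fin_cases i <;> simp) h3
    · exact count ∅ ∅ (by ext i; fin_cases i <;> simp [x0, x1, x2])
        (by ext i; fin_cases i <;> simp) h0
  · rintro ⟨f, hf⟩
    have hlen : 1 * D.indexCodeLen = 5 := by
      simp [DiscretePolymatroid.indexCodeLen, Fin.sum_univ_three, h1, h2, h3]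
    have hcard : 1 * D.indexCodeLen + 2 < Fintype.card D.Msg := by
      rw [hlen]
      simp [DiscretePolymatroid.Msg, Fin.sum_univ_three, h1, h2, h3, hrank]
    let a₀ : D.Msg := Sum.inr ⟨0, ⟨0, by omega⟩⟩
    let a₁ : D.Msg := Sum.inr ⟨0, ⟨1, by omega⟩⟩
    let b₀ : D.Msg := Sum.inr ⟨1, ⟨0, by omega⟩⟩
    let b₁ : D.Msg := Sum.inr ⟨1, ⟨1, by omega⟩⟩
    let c : D.Msg := Sum.inr ⟨2, ⟨0, by omega⟩⟩
    have hab {v : D.Msg → Fin 1 → ZMod 2} (hv : f v = 0)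
        (va₀ : v a₀ = 0) (vb₀ : v b₀ = 0) (vb₁ : v b₁ = 0) : v = 0 :=
      D.eq_zero_of_isBasisVec hf b120 ![{0}, {0, 1}, ∅]
        (by simp [Fin.forall_fin_succ, h1, h2, Finset.insert_subset_iff])
        (by simp [Fin.forall_fin_succ]) hv
        (by simp [Fin.forall_fin_succ]; exact ⟨fun _ => va₀, fun _ => vb₀, fun _ => vb₁⟩)
    have hac₀ {v : D.Msg → Fin 1 → ZMod 2} (hv : f v = 0)
        (va₀ : v a₀ = 0) (vb₀ : v b₀ = 0) (vc : v c = 0) : v = 0 :=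
      D.eq_zero_of_isBasisVec hf b111 ![{0}, {0}, {0}]
        (by simp [Fin.forall_fin_succ, h1, h2, h3])
        (by simp [Fin.forall_fin_succ]) hv
        (by simp [Fin.forall_fin_succ]; exact ⟨fun _ => va₀, fun _ => vb₀, fun _ => vc⟩)
    have hac₁ {v : D.Msg → Fin 1 → ZMod 2} (hv : f v = 0)
        (va₀ : v a₀ = 0) (vb₁ : v b₁ = 0) (vc : v c = 0) : v = 0 :=
      D.eq_zero_of_isBasisVec hf b111 ![{0}, {1}, {0}]
        (by simp [Fin.forall_fin_succ, h1, h2, h3])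
        (by simp [Fin.forall_fin_succ]) hv
        (by simp [Fin.forall_fin_succ]; exact ⟨fun _ => va₀, fun _ => vb₁, fun _ => vc⟩)
    have haab₀ {v : D.Msg → Fin 1 → ZMod 2} (hv : f v = 0)
        (va₀ : v a₀ = 0) (va₁ : v a₁ = 0) (vb₀ : v b₀ = 0) : v = 0 :=
      D.eq_zero_of_isBasisVec hf b210 ![{0, 1}, {0}, ∅]
        (by simp [Fin.forall_fin_succ, h1, h2, Finset.insert_subset_iff])
        (by simp [Fin.forall_fin_succ]) hv
        (by simp [Fin.forall_fin_succ]; exact ⟨⟨fun _ => va₀, fun _ => va₁⟩, fun _ => vb₀⟩)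
    have haab₁ {v : D.Msg → Fin 1 → ZMod 2} (hv : f v = 0)
        (va₀ : v a₀ = 0) (va₁ : v a₁ = 0) (vb₁ : v b₁ = 0) : v = 0 :=
      D.eq_zero_of_isBasisVec hf b210 ![{0, 1}, {1}, ∅]
        (by simp [Fin.forall_fin_succ, h1, h2, Finset.insert_subset_iff])
        (by simp [Fin.forall_fin_succ]) hv
        (by simp [Fin.forall_fin_succ]; exact ⟨⟨fun _ => va₀, fun _ => va₁⟩, fun _ => vb₁⟩)
    have haac {v : D.Msg → Fin 1 → ZMod 2} (hv : f v = 0)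
        (va₀ : v a₀ = 0) (va₁ : v a₁ = 0) (vc : v c = 0) : v = 0 :=
      D.eq_zero_of_isBasisVec hf b201 ![{0, 1}, ∅, {0}]
        (by simp [Fin.forall_fin_succ, h1, h2, h3, Finset.insert_subset_iff])
        (by simp [Fin.forall_fin_succ]) hv
        (by simp [Fin.forall_fin_succ]; exact ⟨⟨fun _ => va₀, fun _ => va₁⟩, fun _ => vc⟩)
    have hcirc {v : D.Msg → Fin 1 → ZMod 2} (hv : f v = 0) (vb₀ : v b₀ = 0)
        (vb₁ : v b₁ = 0) : v c = 0 :=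
      D.eq_zero_of_isMinExcluded hf x021 (by simp) ⟨0, by omega⟩ ![∅, {0, 1}, ∅]
        (by simp [Fin.forall_fin_succ, h2, Finset.insert_subset_iff])
        (by simp [Fin.forall_fin_succ]) (by simp) (by simp) hv
        (by simp [Fin.forall_fin_succ]; exact ⟨fun _ => vb₀, fun _ => vb₁⟩)
    obtain ⟨u, hu, fu, ua, ub₀⟩ := exists_ne_zero_of_two_coords f hcard a₀ b₀
    obtain ⟨w, hw, fw, wa, wb₁⟩ := exists_ne_zero_of_two_coords f hcard a₀ b₁
    obtain ⟨v, hv, fv, va₀, va₁⟩ := exists_ne_zero_of_two_coords f hcard a₀ a₁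
    have ub₁ := eq_one_of_ne_zero fun h => hu (hab fu ua ub₀ h)
    have uc := eq_one_of_ne_zero fun h => hu (hac₀ fu ua ub₀ h)
    have wb₀ := eq_one_of_ne_zero fun h => hw (hab fw wa h wb₁)
    have wc := eq_one_of_ne_zero fun h => hw (hac₁ fw wa wb₁ h)
    have vb₀ := eq_one_of_ne_zero fun h => hv (haab₀ fv va₀ va₁ h)
    have vb₁ := eq_one_of_ne_zero fun h => hv (haab₁ fv va₀ va₁ h)
    have vc := eq_one_of_ne_zero fun h => hv (haac fv va₀ va₁ h)
    have key := hcirc (v := u + w + v) (by simp [fu, fw, fv])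
      (by rw [Pi.add_apply, Pi.add_apply, ub₀, wb₀, vb₀]; decide)
      (by rw [Pi.add_apply, Pi.add_apply, ub₁, wb₁, vb₁]; decide)
    rw [Pi.add_apply, Pi.add_apply, uc, wc, vc] at key
    exact absurd key (by decide)
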